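/- For an involutory knot-theoretic ternary quasigroup (IKTQ) X and every n: ∂_n(C_n^I(X)) ⊆ C_{n-1}^I(X), where ∂_n = ∂_n^L - ∂_n^R. Hence (C_n^I(X), ∂_n) is a chain subcomplex of (C_n(X), ∂_n). -/

import Mathlib

variable {X : Type*}

/-- The reversed operation `T̂`, with `xyzT̂ = zyxT`. -/
def hatOp (S : X → X → X → X) : X → X → X → X := fun x y z => S z y x

/-- Extend an `(n+2)`-tuple `x = (x_0, …, x_{n+1})` to a function on `ℕ`
(values beyond index `n+1` are irrelevant junk). -/
def ext (n : ℕ) (x : Fin (n + 2) → X) : ℕ → X :=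
  fun m => if h : m < n + 2 then x ⟨m, h⟩ else x 0

/-- Coordinate description of the left face maps: `d_{i,k}^{L}` is `x_k` for
`k > i` and `x_{k-1}x_k(d_{i,k+1}^{L}x)T` for `k ≤ i` (computed right to left). -/
def dLcoord (T : X → X → X → X) (i : ℕ) (x : ℕ → X) (k : ℕ) : X :=
  if h : i < k then x k
  else T (x (k - 1)) (x k) (dLcoord T i x (k + 1))
termination_by i + 1 - k
decreasing_by omega

/-- Coordinate description of the right face maps: `d_{i,k}^{R}` is `x_k` for
`k ≤ i` and `(d_{i,k-1}^{R}x)x_kx_{k+1}T` for `k > i` (computed left to right). -/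
def dRcoord (T : X → X → X → X) (i : ℕ) (x : ℕ → X) (k : ℕ) : X :=
  if h : k ≤ i then x k
  else T (dRcoord T i x (k - 1)) (x k) (x (k + 1))
termination_by k
decreasing_by omega

/-- Inductive description of the left face maps:
`d_0^{L}x = (x_1, …, x_{n+1})` and
`d_i^{L}x = d_{i-1}^{L}(x  with  x_i ↦ x_{i-1}x_ix_{i+1}T)`.
The result is indexed so that entry `k` is the `(k+1)`-st coordinate. -/
def dLind (T : X → X → X → X) : ℕ → (ℕ → X) → ℕ → X
  | 0, x, k => x (k + 1)
  | i + 1, x, k =>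
      dLind T i (fun m => if m = i + 1 then T (x i) (x (i + 1)) (x (i + 2)) else x m) k

/-- The left face map `d_i^{n,L}` (coordinate description), as a map from
`(n+2)`-tuples to `(n+1)`-tuples; entry `p` is the coordinate `d_{i,p+1}^{n,L}`. -/
def dL (T : X → X → X → X) (n i : ℕ) (x : Fin (n + 2) → X) : Fin (n + 1) → X :=
  fun p => dLcoord T i (ext n x) (p.1 + 1)

/-- The left face map `d_i^{n,L}` (inductive description). -/
def dLInd (T : X → X → X → X) (n i : ℕ) (x : Fin (n + 2) → X) : Fin (n + 1) → X :=
  fun p => dLind T i (ext n x) p.1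

/-- The right face map `d_i^{n,R}`; entry `p` is the coordinate `d_{i,p}^{n,R}`. -/
def dR (T : X → X → X → X) (n i : ℕ) (x : Fin (n + 2) → X) : Fin (n + 1) → X :=
  fun p => dRcoord T i (ext n x) p.1

/-- The boundary homomorphism `∂_{n}^{L} = Σ_{i=0}^{n} (-1)^i d_i^{n,L}`
on the free abelian group on `(n+2)`-tuples (used for `n ≥ 1`). -/
def boundaryL (T : X → X → X → X) (n : ℕ) :
    FreeAbelianGroup (Fin (n + 2) → X) →+ FreeAbelianGroup (Fin (n + 1) → X) :=
  FreeAbelianGroup.lift fun x =>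
    ∑ i ∈ Finset.range (n + 1), ((-1 : ℤ) ^ i) • FreeAbelianGroup.of (dL T n i x)

/-- The boundary homomorphism `∂_{n}^{R} = Σ_{i=0}^{n} (-1)^i d_i^{n,R}`. -/
def boundaryR (T : X → X → X → X) (n : ℕ) :
    FreeAbelianGroup (Fin (n + 2) → X) →+ FreeAbelianGroup (Fin (n + 1) → X) :=
  FreeAbelianGroup.lift fun x =>
    ∑ i ∈ Finset.range (n + 1), ((-1 : ℤ) ^ i) • FreeAbelianGroup.of (dR T n i x)

/-- The boundary homomorphism `∂_n = ∂_n^L - ∂_n^R`. -/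
def boundary (T : X → X → X → X) (n : ℕ) :
    FreeAbelianGroup (Fin (n + 2) → X) →+ FreeAbelianGroup (Fin (n + 1) → X) :=
  boundaryL T n - boundaryR T n

/-- An `(m+2)`-tuple is degenerate if it contains, on three consecutive
coordinates, a triple `(a, b, abbR)` (condition D1) or `(bbaL, b, a)`
(condition D2). -/
def IsDegenerate (L R : X → X → X → X) (m : ℕ) (x : Fin (m + 2) → X) : Prop :=
  ∃ (j : ℕ) (h : j + 2 < m + 2) (a b : X),
    (x ⟨j, by omega⟩ = a ∧ x ⟨j + 1, by omega⟩ = b ∧ x ⟨j + 2, h⟩ = R a b b) ∨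
    (x ⟨j, by omega⟩ = L b b a ∧ x ⟨j + 1, by omega⟩ = b ∧ x ⟨j + 2, h⟩ = a)

/-- `C_m^D(X)`: the subgroup of `C_m(X)` generated by the degenerate tuples. -/
def CD (L R : X → X → X → X) (m : ℕ) :
    AddSubgroup (FreeAbelianGroup (Fin (m + 2) → X)) :=
  AddSubgroup.closure {c | ∃ x, IsDegenerate L R m x ∧ c = FreeAbelianGroup.of x}

/-- `x[j]`: the tuple obtained from `x` by replacing `x_j` with `x_{j-1}x_jx_{j+1}T`. -/
def tupleSub (T : X → X → X → X) (m : ℕ) (x : Fin (m + 2) → X) (j : ℕ)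
    (h1 : 1 ≤ j) (h2 : j ≤ m) : Fin (m + 2) → X :=
  Function.update x ⟨j, by omega⟩
    (T (x ⟨j - 1, by omega⟩) (x ⟨j, by omega⟩) (x ⟨j + 1, by omega⟩))

/-- `C_m^I(X)`: the subgroup of `C_m(X)` generated by the sums `x + x[j]`,
`1 ≤ j ≤ m`. -/
def CI (T : X → X → X → X) (m : ℕ) :
    AddSubgroup (FreeAbelianGroup (Fin (m + 2) → X)) :=
  AddSubgroup.closure {c | ∃ (x : Fin (m + 2) → X) (j : ℕ) (h1 : 1 ≤ j) (h2 : j ≤ m),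
    c = FreeAbelianGroup.of x + FreeAbelianGroup.of (tupleSub T m x j h1 h2)}

/-- `C_m^{ID}(X)`: the subgroup of `C_m(X)` generated by the sums `x + x[j]`
together with the degenerate tuples. -/
def CID (T L R : X → X → X → X) (m : ℕ) :
    AddSubgroup (FreeAbelianGroup (Fin (m + 2) → X)) :=
  AddSubgroup.closure
    ({c | ∃ (x : Fin (m + 2) → X) (j : ℕ) (h1 : 1 ≤ j) (h2 : j ≤ m),
        c = FreeAbelianGroup.of x + FreeAbelianGroup.of (tupleSub T m x j h1 h2)} ∪
      {c | ∃ x, IsDegenerate L R m x ∧ c = FreeAbelianGroup.of x})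

/-- Reversal of a tuple. -/
def revTuple {m : ℕ} (x : Fin m → X) : Fin m → X := fun k => x k.rev

/-- The move `x ↦ x[t+1]` on sequences: replace `x_{t+1}` by `x_tx_{t+1}x_{t+2}T`. -/
def seqSub (T : X → X → X → X) (t : ℕ) (x : ℕ → X) : ℕ → X :=
  fun m => if m = t + 1 then T (x t) (x (t + 1)) (x (t + 2)) else x m

lemma seqSub_involutive (T : X → X → X → X) (hinv : ∀ a x b : X, T a (T a x b) b = x)
    (t : ℕ) (x : ℕ → X) : seqSub T t (seqSub T t x) = x := by
  funext m
  by_cases hm : m = t + 1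
  · subst hm; simp [seqSub, hinv]
  · simp [seqSub, hm]

lemma seqSub_comm (T : X → X → X → X) {s t : ℕ} (h : s + 1 < t) (x : ℕ → X) :
    seqSub T s (seqSub T t x) = seqSub T t (seqSub T s x) := by
  funext m
  by_cases hs : m = s + 1
  · subst hs
    simp [seqSub, show s ≠ t + 1 by omega, show s ≠ t by omega, show s + 1 ≠ t by omega]
  · by_cases ht : m = t + 1
    · subst ht
      simp [seqSub, show t ≠ s + 1 by omega, show t ≠ s by omega, show t + 1 ≠ s by omega]
    · simp [seqSub, hs, ht]

lemma seqSub_braid (T : X → X → X → X)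
    (hA3L : ∀ a b c d : X, T (T a b c) c d = T (T a b (T b c d)) (T b c d) d)
    (hA3R : ∀ a b c d : X, T a b (T b c d) = T a (T a b c) (T (T a b c) c d))
    (t : ℕ) (x : ℕ → X) :
    seqSub T t (seqSub T (t + 1) (seqSub T t x)) =
      seqSub T (t + 1) (seqSub T t (seqSub T (t + 1) x)) := by
  funext m
  by_cases h₁ : m = t + 1
  · subst h₁
    simp [seqSub, show t ≠ t + 1 + 1 by omega, ← hA3R]
  · by_cases h₂ : m = t + 2
    · subst h₂
      simp [seqSub, show t ≠ t + 1 + 1 by omega, ← hA3L]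
    · simp [seqSub, h₁, h₂]

/-- The left face map on sequences, with coordinates shifted down by one. -/
def seqL (T : X → X → X → X) (i : ℕ) (x : ℕ → X) : ℕ → X :=
  fun k => dLcoord T i x (k + 1)

lemma dLcoord_seqSub (T : X → X → X → X) (i : ℕ) (x : ℕ → X) (k : ℕ) :
    dLcoord T i (seqSub T i x) k = dLcoord T (i + 1) x k := by
  rcases lt_or_ge (i + 1) k with h | h
  · rw [dLcoord, dif_pos (by omega), dLcoord, dif_pos h]
    simp [seqSub, show k ≠ i + 1 by omega]
  · induction h using Nat.decreasingInduction with
    | self =>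
      rw [dLcoord, dif_pos (by omega), dLcoord, dif_neg (by omega), dLcoord, dif_pos (by omega)]
      simp [seqSub]
    | of_succ k hk ih =>
      rw [dLcoord, dif_neg (by omega), ih, dLcoord.eq_1 T (i + 1) x k, dif_neg (by omega)]
      simp [seqSub, show k ≠ i + 1 by omega, show k - 1 ≠ i + 1 by omega]

lemma seqL_seqSub_self (T : X → X → X → X) (i : ℕ) (x : ℕ → X) :
    seqL T i (seqSub T i x) = seqL T (i + 1) x :=
  funext fun k => dLcoord_seqSub T i x (k + 1)

lemma seqL_zero (T : X → X → X → X) (x : ℕ → X) : seqL T 0 x = fun k => x (k + 1) := by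
  funext k
  rw [seqL, dLcoord, dif_pos (by omega)]

lemma seqL_seqSub_of_le (T : X → X → X → X) {i t : ℕ} (h : i ≤ t) (x : ℕ → X) :
    seqL T i (seqSub T (t + 1) x) = seqSub T t (seqL T i x) := by
  induction i generalizing x with
  | zero =>
    funext k
    simp [seqL_zero, seqSub]
  | succ i ih =>
    rw [← seqL_seqSub_self, seqSub_comm T (by omega), ih (by omega), seqL_seqSub_self]

lemma seqL_seqSub_of_lt (T : X → X → X → X)
    (hA3L : ∀ a b c d : X, T (T a b c) c d = T (T a b (T b c d)) (T b c d) d)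
    (hA3R : ∀ a b c d : X, T a b (T b c d) = T a (T a b c) (T (T a b c) c d))
    {i t : ℕ} (h : t + 1 < i) (x : ℕ → X) :
    seqL T i (seqSub T t x) = seqSub T t (seqL T i x) := by
  induction i generalizing x with
  | zero => omega
  | succ i ih =>
    rw [← seqL_seqSub_self]
    rcases Nat.lt_succ_iff_lt_or_eq.mp h with hlt | rfl
    · rw [← seqSub_comm T (by omega), ih hlt, seqL_seqSub_self]
    · rw [← seqL_seqSub_self, seqSub_braid T hA3L hA3R, seqL_seqSub_of_le T le_rfl,
        seqL_seqSub_self, seqL_seqSub_self]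

lemma dRcoord_of_le (T : X → X → X → X) {i k : ℕ} (h : k ≤ i) (x : ℕ → X) :
    dRcoord T i x k = x k := by
  rw [dRcoord, dif_pos h]

lemma dRcoord_succ (T : X → X → X → X) {i k : ℕ} (h : i ≤ k) (x : ℕ → X) :
    dRcoord T i x (k + 1) = T (dRcoord T i x k) (x (k + 1)) (x (k + 2)) := by
  rw [dRcoord, dif_neg (by omega)]
  rfl

lemma dRcoord_seqSub_self (T : X → X → X → X) (i : ℕ) (x : ℕ → X) :
    dRcoord T (i + 1) (seqSub T i x) = dRcoord T i x := by
  funext k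
  induction k with
  | zero => simp [dRcoord_of_le, seqSub]
  | succ k ih =>
    rcases lt_trichotomy k i with h | rfl | h
    · rw [dRcoord_of_le T (by omega), dRcoord_of_le T (by omega)]
      simp [seqSub, h.ne]
    · rw [dRcoord_of_le T le_rfl, dRcoord_succ T le_rfl, dRcoord_of_le T le_rfl]
      simp [seqSub]
    · rw [dRcoord_succ T h, dRcoord_succ T (by omega), ih]
      simp [seqSub, h.ne', show k + 1 ≠ i by omega]

lemma dRcoord_seqSub_of_lt (T : X → X → X → X) {i t : ℕ} (h : t + 1 < i) (x : ℕ → X) :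
    dRcoord T i (seqSub T t x) = seqSub T t (dRcoord T i x) := by
  have key (y : ℕ → X) {k : ℕ} (hk : k ≤ i) : dRcoord T i y k = y k := dRcoord_of_le T hk y
  funext k
  induction k with
  | zero => simp [key, seqSub]
  | succ k ih =>
    rcases lt_or_ge k i with hk | hk
    · rw [key _ hk]
      simp [seqSub, key _ hk, key _ (show t ≤ i by omega), key _ (show t + 1 ≤ i by omega),
        key _ (show t + 2 ≤ i by omega)]
    · rw [dRcoord_succ T hk, ih]
      simp [seqSub, dRcoord_succ T hk, show k ≠ t + 1 by omega, show k ≠ t by omega,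
        show k + 1 ≠ t by omega]

lemma dRcoord_seqSub_of_le (T : X → X → X → X)
    (hA3L : ∀ a b c d : X, T (T a b c) c d = T (T a b (T b c d)) (T b c d) d)
    (hA3R : ∀ a b c d : X, T a b (T b c d) = T a (T a b c) (T (T a b c) c d))
    {i t : ℕ} (h : i ≤ t) (x : ℕ → X) :
    dRcoord T i (seqSub T (t + 1) x) = seqSub T t (dRcoord T i x) := by
  have low (k : ℕ) (hk : k ≤ t) : dRcoord T i (seqSub T (t + 1) x) k = dRcoord T i x k := by
    induction k with
    | zero => simp [dRcoord_of_le, seqSub]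
    | succ k ih =>
      rcases lt_or_ge k i with hki | hki
      · rw [dRcoord_of_le T hki, dRcoord_of_le T hki]
        simp [seqSub, show k ≠ t + 1 by omega]
      · rw [dRcoord_succ T hki, dRcoord_succ T hki, ih (by omega)]
        simp [seqSub, show k ≠ t + 1 by omega, show k ≠ t by omega]
  have mid : dRcoord T i (seqSub T (t + 1) x) (t + 1) =
      T (dRcoord T i x t) (x (t + 1)) (T (x (t + 1)) (x (t + 2)) (x (t + 3))) := by
    rw [dRcoord_succ T h, low t le_rfl]
    simp [seqSub]
  have high (k : ℕ) : dRcoord T i (seqSub T (t + 1) x) (t + 2 + k) =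
      dRcoord T i x (t + 2 + k) := by
    induction k with
    | zero =>
      rw [add_zero, dRcoord_succ T (by omega), mid, dRcoord_succ T (by omega), dRcoord_succ T h,
        hA3L]
      simp [seqSub]
    | succ k ih =>
      rw [← add_assoc, dRcoord_succ T (by omega), ih, dRcoord_succ T (by omega)]
      simp [seqSub, show t + 2 + k ≠ t + 1 by omega, show t + 2 + k ≠ t by omega]
  funext k
  rcases lt_trichotomy k (t + 1) with hk | rfl | hk
  · rw [low k (by omega)]
    simp [seqSub, hk.ne]
  · rw [mid, hA3R]
    simp [seqSub, dRcoord_succ T h, dRcoord_succ T (show i ≤ t + 1 by omega)]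
  · obtain ⟨m, rfl⟩ := Nat.exists_eq_add_of_le (show t + 2 ≤ k by omega)
    rw [high]
    simp [seqSub, hk.ne']

lemma ext_tupleSub (T : X → X → X → X) {m t : ℕ} (ht : t + 1 ≤ m) (x : Fin (m + 2) → X) :
    ext m (tupleSub T m x (t + 1) (by omega) ht) = seqSub T t (ext m x) := by
  funext k
  by_cases hk : k = t + 1
  · subst hk
    simp [ext, seqSub, tupleSub, show t + 1 < m + 2 by omega, show t < m + 2 by omega,
      show t < m by omega]
  · by_cases hkm : k < m + 2
    · simp [ext, seqSub, tupleSub, hk, hkm]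
    · simp [ext, seqSub, tupleSub, hk, hkm, Fin.ext_iff]

lemma add_restrict_seqSub_mem_CI (T : X → X → X → X) {m t : ℕ} (ht : t + 1 ≤ m) (y : ℕ → X) :
    FreeAbelianGroup.of (fun p : Fin (m + 2) => y p) +
      FreeAbelianGroup.of (fun p : Fin (m + 2) => seqSub T t y p) ∈ CI T m := by
  refine AddSubgroup.subset_closure ⟨fun p => y p, t + 1, by omega, ht, ?_⟩
  congr 2
  funext p
  simp [seqSub, tupleSub, Function.update_apply, Fin.ext_iff]

lemma alternating_sum_mem {G : Type*} [AddCommGroup G] (H : AddSubgroup G) (f : ℕ → G)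
    {m t : ℕ} (ht : t + 1 < m) (heq : f t = f (t + 1))
    (hmem : ∀ i < m, i ≠ t → i ≠ t + 1 → f i ∈ H) :
    ∑ i ∈ Finset.range m, ((-1 : ℤ) ^ i) • f i ∈ H := by
  rw [← Finset.add_sum_erase _ _ (Finset.mem_range.mpr (show t < m by omega)),
    ← Finset.add_sum_erase _ _ (Finset.mem_erase.mpr
      ⟨show t + 1 ≠ t by omega, Finset.mem_range.mpr ht⟩), ← add_assoc, ← heq, ← add_smul]
  have hsign : (-1 : ℤ) ^ t + (-1) ^ (t + 1) = 0 := by ring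
  rw [hsign, zero_smul, zero_add]
  refine H.sum_mem fun i hi => H.zsmul_mem (hmem i ?_ ?_ ?_) _ <;> simp_all

/-- for an IKTQ `X` (a ternary quasigroup `(X,T,L,T,R)`, i.e.
with `T = M`, satisfying A3L and A3R) and every `n`,
`∂_n(C_n^I(X)) ⊆ C_{n-1}^I(X)` where `∂_n = ∂_n^L - ∂_n^R`; hence
`(C_n^I(X), ∂_n)` is a chain subcomplex of `(C_n(X), ∂_n)`. -/
theorem boundary_maps_CI_into_CI {X : Type*} (T L R : X → X → X → X)
    (hq1 : ∀ x1 x2 x3 : X, L (T x1 x2 x3) x2 x3 = x1)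
    (hq2 : ∀ x1 x2 x3 : X, T (L x1 x2 x3) x2 x3 = x1)
    (hinv : ∀ x1 x2 x3 : X, T x1 (T x1 x2 x3) x3 = x2)
    (hq5 : ∀ x1 x2 x3 : X, R x1 x2 (T x1 x2 x3) = x3)
    (hq6 : ∀ x1 x2 x3 : X, T x1 x2 (R x1 x2 x3) = x3)
    (hA3L : ∀ a b c d : X, T (T a b c) c d = T (T a b (T b c d)) (T b c d) d)
    (hA3R : ∀ a b c d : X, T a b (T b c d) = T a (T a b c) (T (T a b c) c d)) :
    ∀ n : ℕ, ∀ c ∈ CI T (n + 1), boundary T (n + 1) c ∈ CI T n := by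
  intro n c hc
  induction hc using AddSubgroup.closure_induction with
  | zero => simp
  | add a b _ _ ha hb => rw [map_add]; exact add_mem ha hb
  | neg a _ ha => rw [map_neg]; exact neg_mem ha
  | mem c hc =>
    obtain ⟨x, j, h1, h2, rfl⟩ := hc
    obtain ⟨t, rfl⟩ := Nat.exists_eq_add_of_le' h1
    have hL (i : ℕ) (y : Fin (n + 1 + 2) → X) :
        dL T (n + 1) i y = fun p : Fin (n + 2) => seqL T i (ext (n + 1) y) p := rfl
    have hR (i : ℕ) (y : Fin (n + 1 + 2) → X) :
        dR T (n + 1) i y = fun p : Fin (n + 2) => dRcoord T i (ext (n + 1) y) p := rfl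
    rw [boundary, AddMonoidHom.sub_apply, map_add, map_add]
    simp only [boundaryL, boundaryR,
      FreeAbelianGroup.lift_apply_of, ← Finset.sum_add_distrib, ← smul_add, hL, hR,
      ext_tupleSub T h2]
    generalize ext (n + 1) x = y
    refine sub_mem (alternating_sum_mem _ _ (t := t) (by omega) ?_ fun i hi ht ht' => ?_)
      (alternating_sum_mem _ _ (t := t) (by omega) ?_ fun i hi ht ht' => ?_)
    · rw [← seqL_seqSub_self T t (seqSub T t y), seqSub_involutive T hinv, seqL_seqSub_self]
      exact add_comm _ _
    · rcases lt_or_ge i t with h | h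
      · obtain ⟨s, rfl⟩ := Nat.exists_eq_add_of_le' (show 1 ≤ t by omega)
        rw [seqL_seqSub_of_le T (by omega)]
        exact add_restrict_seqSub_mem_CI T (by omega) _
      · rw [seqL_seqSub_of_lt T hA3L hA3R (by omega)]
        exact add_restrict_seqSub_mem_CI T (by omega) _
    · rw [← dRcoord_seqSub_self T t (seqSub T t y), seqSub_involutive T hinv,
        dRcoord_seqSub_self]
      exact add_comm _ _
    · rcases lt_or_ge i t with h | h
      · obtain ⟨s, rfl⟩ := Nat.exists_eq_add_of_le' (show 1 ≤ t by omega)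
        rw [dRcoord_seqSub_of_le T hA3L hA3R (by omega)]
        exact add_restrict_seqSub_mem_CI T (by omega) _
      · rw [dRcoord_seqSub_of_lt T (by omega)]
        exact add_restrict_seqSub_mem_CI T (by omega) _
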